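/- Let λ, ν, κ be pairwise distinct positive reals and let a, b be real. Then ∫_{−∞}^{∞} ∫_{−∞}^{∞} (e^(−λ·|a−y|)/(2λ)) · (e^(−ν·|y−z|)/(2ν)) · (e^(−κ·|z−b|)/(2κ)) dy dz = e^(−κ·|a−b|) / (2κ·(κ²−ν²)·(κ²−λ²)) + e^(−ν·|a−b|) / (2ν·(ν²−λ²)·(ν²−κ²)) + e^(−λ·|a−b|) / (2λ·(λ²−ν²)·(λ²−κ²)). -/

import Mathlib

open MeasureTheory Real

theorem integrable_exp_neg_mul_abs_sub {p : ℝ} (hp : 0 < p) (a : ℝ) :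
    Integrable fun y : ℝ => exp (-p * |a - y|) := by
  rw [← integrableOn_univ, ← Set.Iic_union_Ioi (a := a)]
  refine IntegrableOn.union ?_ ?_
  · refine IntegrableOn.congr_fun ((integrableOn_exp_mul_Iic hp a).const_mul (exp (-p * a)))
      (fun y hy => ?_) measurableSet_Iic
    have hya : y ≤ a := hy
    simp only [← exp_add, abs_of_nonneg (sub_nonneg.2 hya)]
    ring_nf
  · refine IntegrableOn.congr_fun
      ((integrableOn_exp_mul_Ioi (neg_lt_zero.2 hp) a).const_mul (exp (p * a)))
      (fun y hy => ?_) measurableSet_Ioi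
    have hay : a ≤ y := le_of_lt hy
    simp only [← exp_add, abs_of_nonpos (sub_nonpos.2 hay)]
    ring_nf

theorem integrable_exp_neg_mul_abs_mul_exp_neg_mul_abs {p q : ℝ} (hp : 0 < p) (hq : 0 < q)
    (a z : ℝ) : Integrable fun y : ℝ => exp (-p * |a - y|) * exp (-q * |y - z|) := by
  refine (integrable_exp_neg_mul_abs_sub hp a).mul_bdd (c := 1)
    (by fun_prop : Continuous fun y : ℝ => exp (-q * |y - z|)).aestronglyMeasurable
    (ae_of_all _ fun y => ?_)
  rw [norm_of_nonneg (exp_pos _).le, exp_le_one_iff]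
  nlinarith [abs_nonneg (y - z)]

theorem intervalIntegral_exp_mul {c : ℝ} (hc : c ≠ 0) (a b : ℝ) :
    ∫ x in a..b, exp (c * x) = (exp (c * b) - exp (c * a)) / c := by
  rw [intervalIntegral.integral_comp_mul_left _ hc, integral_exp, smul_eq_mul]
  ring

/-- Convolution of two exponential kernels with distinct decay rates. -/
theorem integral_exp_neg_mul_abs_mul_exp_neg_mul_abs {p q : ℝ} (hp : 0 < p) (hq : 0 < q)
    (hpq : p ≠ q) (a z : ℝ) :
    ∫ y : ℝ, exp (-p * |a - y|) * exp (-q * |y - z|) =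
      2 * p / (p ^ 2 - q ^ 2) * exp (-q * |a - z|) -
        2 * q / (p ^ 2 - q ^ 2) * exp (-p * |a - z|) := by
  wlog haz : a ≤ z generalizing p q a z
  · have h := this hq hp hpq.symm z a (le_of_not_ge haz)
    simp only [abs_sub_comm z, mul_comm (exp (-q * _))] at h
    simp only [abs_sub_comm a, abs_sub_comm _ z] at h ⊢
    rw [h, ← neg_sub (p ^ 2) (q ^ 2)]
    simp only [div_neg]
    ring
  have hint := integrable_exp_neg_mul_abs_mul_exp_neg_mul_abs hp hq a z
  have hleft : ∫ y in Set.Iic a, exp (-p * |a - y|) * exp (-q * |y - z|) =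
      exp (-q * (z - a)) / (p + q) := by
    rw [setIntegral_congr_fun (g := fun y => exp (-p * a - q * z) * exp ((p + q) * y))
      measurableSet_Iic fun y hy => ?_, integral_const_mul,
      integral_exp_mul_Iic (add_pos hp hq), ← mul_div_assoc, ← exp_add]
    · ring_nf
    · have hya : y ≤ a := hy
      simp only [← exp_add, abs_of_nonneg (sub_nonneg.2 hya),
        abs_of_nonpos (sub_nonpos.2 (hya.trans haz))]
      ring_nf
  have hmid : ∫ y in a..z, exp (-p * |a - y|) * exp (-q * |y - z|) =
      (exp (-p * (z - a)) - exp (-q * (z - a))) / (q - p) := by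
    rw [intervalIntegral.integral_congr
      (g := fun y => exp (p * a - q * z) * exp ((q - p) * y)) fun y hy => ?_,
      intervalIntegral.integral_const_mul,
      intervalIntegral_exp_mul (sub_ne_zero.2 hpq.symm), ← mul_div_assoc, mul_sub,
      ← exp_add, ← exp_add]
    · ring_nf
    · rw [Set.uIcc_of_le haz] at hy
      simp only [← exp_add, abs_of_nonpos (sub_nonpos.2 hy.1),
        abs_of_nonpos (sub_nonpos.2 hy.2)]
      ring_nf
  have hright : ∫ y in Set.Ioi z, exp (-p * |a - y|) * exp (-q * |y - z|) =
      exp (-p * (z - a)) / (p + q) := by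
    rw [setIntegral_congr_fun (g := fun y => exp (p * a + q * z) * exp (-(p + q) * y))
      measurableSet_Ioi fun y hy => ?_, integral_const_mul,
      integral_exp_mul_Ioi (neg_lt_zero.2 (add_pos hp hq)), neg_div_neg_eq, ← mul_div_assoc,
      ← exp_add]
    · ring_nf
    · have hzy : z ≤ y := le_of_lt hy
      simp only [← exp_add, abs_of_nonpos (sub_nonpos.2 (haz.trans hzy)),
        abs_of_nonneg (sub_nonneg.2 hzy)]
      ring_nf
  rw [← intervalIntegral.integral_Iic_add_Ioi (b := a) hint.integrableOn hint.integrableOn,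
    ← intervalIntegral.integral_interval_add_Ioi (b := z) hint.integrableOn hint.integrableOn,
    hleft, hmid, hright, abs_of_nonpos (sub_nonpos.2 haz), neg_sub,
    show p ^ 2 - q ^ 2 = -((p + q) * (q - p)) by ring]
  have hadd : p + q ≠ 0 := (add_pos hp hq).ne'
  have hsub : q - p ≠ 0 := sub_ne_zero.2 hpq.symm
  field_simp
  ring

/-- Double convolution of three one-dimensional exponential Green kernels (the `d = 1` AdS
three-line chain diagram). -/
theorem three_line_chain_dim_one (lam nu kap a b : ℝ)
    (hlam : 0 < lam) (hnu : 0 < nu) (hkap : 0 < kap)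
    (h1 : lam ≠ nu) (h2 : nu ≠ kap) (h3 : lam ≠ kap) :
    ∫ z : ℝ, ∫ y : ℝ,
        Real.exp (-lam * |a - y|) / (2 * lam) * (Real.exp (-nu * |y - z|) / (2 * nu)) *
          (Real.exp (-kap * |z - b|) / (2 * kap)) =
      Real.exp (-kap * |a - b|) / (2 * kap * (kap ^ 2 - nu ^ 2) * (kap ^ 2 - lam ^ 2)) +
        Real.exp (-nu * |a - b|) / (2 * nu * (nu ^ 2 - lam ^ 2) * (nu ^ 2 - kap ^ 2)) +
        Real.exp (-lam * |a - b|) / (2 * lam * (lam ^ 2 - nu ^ 2) * (lam ^ 2 - kap ^ 2)) := by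
  have hsq {p q : ℝ} (hp : 0 < p) (hq : 0 < q) (hpq : p ≠ q) : p ^ 2 - q ^ 2 ≠ 0 :=
    sub_ne_zero.2 fun h => hpq ((sq_eq_sq₀ hp.le hq.le).1 h)
  have hinner (z : ℝ) :
      ∫ y : ℝ, exp (-lam * |a - y|) / (2 * lam) * (exp (-nu * |y - z|) / (2 * nu)) *
          (exp (-kap * |z - b|) / (2 * kap)) =
        1 / (4 * nu * kap * (lam ^ 2 - nu ^ 2)) * (exp (-nu * |a - z|) * exp (-kap * |z - b|)) -
          1 / (4 * lam * kap * (lam ^ 2 - nu ^ 2)) *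
            (exp (-lam * |a - z|) * exp (-kap * |z - b|)) := by
    have hfactor (y : ℝ) :
        exp (-lam * |a - y|) / (2 * lam) * (exp (-nu * |y - z|) / (2 * nu)) *
            (exp (-kap * |z - b|) / (2 * kap)) =
          exp (-kap * |z - b|) / (8 * lam * nu * kap) *
            (exp (-lam * |a - y|) * exp (-nu * |y - z|)) := by
      field_simp
      ring
    simp_rw [hfactor]
    rw [integral_const_mul, integral_exp_neg_mul_abs_mul_exp_neg_mul_abs hlam hnu h1]
    have hd : lam ^ 2 - nu ^ 2 ≠ 0 := hsq hlam hnu h1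
    field_simp
    ring
  simp_rw [hinner]
  rw [integral_sub
      ((integrable_exp_neg_mul_abs_mul_exp_neg_mul_abs hnu hkap a b).const_mul _)
      ((integrable_exp_neg_mul_abs_mul_exp_neg_mul_abs hlam hkap a b).const_mul _),
    integral_const_mul, integral_const_mul,
    integral_exp_neg_mul_abs_mul_exp_neg_mul_abs hnu hkap h2,
    integral_exp_neg_mul_abs_mul_exp_neg_mul_abs hlam hkap h3,
    ← neg_sub (nu ^ 2) (kap ^ 2), ← neg_sub (lam ^ 2) (kap ^ 2), ← neg_sub (lam ^ 2) (nu ^ 2)]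
  have hd₁ := hsq hlam hnu h1
  have hd₂ := hsq hnu hkap h2
  have hd₃ := hsq hlam hkap h3
  field_simp
  ring
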